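/- arXiv:0806.3205 — 5 statements merged into one kernel-verified Lean document; each statement's English description precedes it below -/
import Mathlib

section
/- Fix n ≥ 1 and let ν be any submultiplicative norm on the algebra of n×n complex matrices (a norm with ν(A·B) ≤ ν(A)·ν(B)). Then every semicharacter f on the topological group GL_n(ℂ) (with the topology inherited from the space of matrices) is majorized by a semicharacter of the form r(x) = C·(max(ν(x), ν(x⁻¹)))^N: there exist C ≥ 1 and N ∈ ℕ such that f(x) ≤ C·(max(ν(x), ν(x⁻¹)))^N for all x ∈ GL_n(ℂ). -/
/-- A semicharacter on a topological group `G`: a locally bounded function `f : G → ℝ`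
with `f ≥ 1` which is submultiplicative. -/
structure IsSemicharacter {G : Type*} [Group G] [TopologicalSpace G] (f : G → ℝ) : Prop where
  locallyBounded : ∀ x : G, ∃ U ∈ nhds x, ∃ M : ℝ, ∀ y ∈ U, f y ≤ M
  one_le : ∀ x : G, 1 ≤ f x
  submul : ∀ x y : G, f (x * y) ≤ f x * f y

open Matrix

namespace IsSemicharacter

variable {G : Type*} [Group G] [TopologicalSpace G] {f : G → ℝ}

/-- A semicharacter is bounded on compact sets. -/
theorem exists_bound_of_isCompact (hf : IsSemicharacter f) {K : Set G} (hK : IsCompact K) :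
    ∃ M : ℝ, ∀ x ∈ K, f x ≤ M := by
  refine hK.induction_on (p := fun s => ∃ M : ℝ, ∀ x ∈ s, f x ≤ M) ⟨0, by simp⟩ ?_ ?_ ?_
  · rintro s t hst ⟨M, hM⟩
    exact ⟨M, fun x hx => hM x (hst hx)⟩
  · rintro s t ⟨M, hM⟩ ⟨M', hM'⟩
    refine ⟨max M M', ?_⟩
    rintro x (hx | hx)
    · exact (hM x hx).trans (le_max_left _ _)
    · exact (hM' x hx).trans (le_max_right _ _)
  · intro x _
    obtain ⟨U, hU, M, hM⟩ := hf.locallyBounded x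
    exact ⟨U, mem_nhdsWithin_of_mem_nhds hU, M, hM⟩

theorem pow_succ_le (hf : IsSemicharacter f) (x : G) (k : ℕ) : f (x ^ (k + 1)) ≤ f x ^ (k + 1) := by
  induction k with
  | zero => simp
  | succ k ih =>
    rw [pow_succ x, pow_succ (f x)]
    exact (hf.submul _ _).trans
      (mul_le_mul_of_nonneg_right ih (zero_le_one.trans (hf.one_le x)))

end IsSemicharacter

namespace Matrix

variable {ι : Type*} [Fintype ι] [DecidableEq ι]

/-- The invertible diagonal matrix with entries `exp (t i)`. -/
noncomputable def expDiag (t : ι → ℝ) : GL ι ℂ where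
  val := diagonal fun i => (Real.exp (t i) : ℂ)
  inv := diagonal fun i => (Real.exp (-t i) : ℂ)
  val_inv := by simp [← Complex.exp_add]
  inv_val := by simp [← Complex.exp_add]

theorem coe_expDiag (t : ι → ℝ) :
    (expDiag t : Matrix ι ι ℂ) = diagonal fun i => (Real.exp (t i) : ℂ) := rfl

theorem expDiag_neg (t : ι → ℝ) : expDiag (-t) = (expDiag t)⁻¹ :=
  Units.ext rfl

theorem expDiag_nsmul (k : ℕ) (t : ι → ℝ) : expDiag (k • t) = expDiag t ^ k := by
  apply Units.ext
  rw [Units.val_pow_eq_pow_val, coe_expDiag, coe_expDiag, diagonal_pow]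
  congr 1
  ext i
  simp [← Complex.exp_nat_mul]

theorem continuous_expDiag : Continuous (expDiag : (ι → ℝ) → GL ι ℂ) := by
  refine Units.continuous_iff.2 ⟨?_, ?_⟩
  · change Continuous fun t : ι → ℝ => diagonal fun i => (Real.exp (t i) : ℂ)
    fun_prop
  · change Continuous fun t : ι → ℝ => diagonal fun i => (Real.exp (-t i) : ℂ)
    fun_prop

theorem isCompact_unitaryGroup : IsCompact (unitaryGroup ι ℂ : Set (Matrix ι ι ℂ)) := by
  have hbox : IsCompact {A : Matrix ι ι ℂ | ∀ i, A i ∈ {r : ι → ℂ | ∀ j, r j ∈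
      Metric.closedBall (0 : ℂ) 1}} :=
    isCompact_pi_infinite fun _ => isCompact_pi_infinite fun _ => isCompact_closedBall _ _
  refine hbox.of_isClosed_subset isClosed_unitary fun U hU i j => ?_
  simpa using entry_norm_bound_of_unitary hU i j

theorem continuous_unitary_toUnits :
    Continuous (Unitary.toUnits : unitaryGroup ι ℂ → GL ι ℂ) := by
  refine Units.continuous_iff.2 ⟨continuous_subtype_val, ?_⟩
  exact continuous_star.comp continuous_subtype_val

open scoped ComplexOrder in
/-- **Singular value decomposition** of an invertible complex matrix. -/
theorem exists_eq_unitary_mul_expDiag_mul_unitary (x : GL ι ℂ) :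
    ∃ (u v : unitaryGroup ι ℂ) (t : ι → ℝ),
      x = Unitary.toUnits u * expDiag t * Unitary.toUnits v := by
  set X : Matrix ι ι ℂ := ↑x with hX
  have hpos : (Xᴴ * X).PosDef := PosDef.conjTranspose_mul_self X
    (mulVec_injective_of_isUnit x.isUnit)
  set lam := hpos.1.eigenvalues
  set V := hpos.1.eigenvectorUnitary
  set t : ι → ℝ := fun i => Real.log (lam i) / 2 with ht
  have hlam (i : ι) : Real.exp (t i) * Real.exp (t i) = lam i := by
    rw [← Real.exp_add, ht]
    simp only [add_halves]
    exact Real.exp_log (hpos.eigenvalues_pos i)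
  have hspec : star (V : Matrix ι ι ℂ) * (Xᴴ * X) * V =
      diagonal fun i => (lam i : ℂ) := by
    have h := hpos.1.conjStarAlgAut_star_eigenvectorUnitary
    rw [Unitary.conjStarAlgAut_star_apply] at h
    exact h
  have hD : diagonal (fun i => (lam i : ℂ)) = (expDiag t : Matrix ι ι ℂ) * expDiag t := by
    simp only [coe_expDiag, diagonal_mul_diagonal, ← Complex.ofReal_mul, hlam]
  have hDstar : star ((expDiag t)⁻¹ : GL ι ℂ).val = ((expDiag t)⁻¹ : GL ι ℂ).val := by
    rw [← expDiag_neg, coe_expDiag, star_eq_conjTranspose, diagonal_conjTranspose]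
    congr 1
    ext i
    exact Complex.conj_ofReal _
  set W : Matrix ι ι ℂ := X * V * ((expDiag t)⁻¹ : GL ι ℂ).val with hW
  have hWu : W ∈ unitaryGroup ι ℂ := by
    rw [mem_unitaryGroup_iff']
    calc star W * W
        = ((expDiag t)⁻¹ : GL ι ℂ).val * (star (V : Matrix ι ι ℂ) * (Xᴴ * X) * V) *
            ((expDiag t)⁻¹ : GL ι ℂ).val := by
          rw [hW, star_mul, star_mul, hDstar, star_eq_conjTranspose X]
          simp only [mul_assoc]
      _ = 1 := by
          rw [hspec, hD, Units.inv_mul_cancel_left, Units.mul_inv]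
  refine ⟨⟨W, hWu⟩, star V, t, Units.ext ?_⟩
  change X = W * (expDiag t).val * star (V : Matrix ι ι ℂ)
  rw [hW, Units.inv_mul_cancel_right, mul_assoc, Unitary.mul_star_self_of_mem V.2, mul_one]

end Matrix

section SubmultiplicativeNorm

variable {ι : Type*} [Fintype ι] [DecidableEq ι] {ν : Matrix ι ι ℂ → ℝ}

/-- A norm on matrices is bounded on the unitary group. -/
theorem exists_bound_norm_unitaryGroup (hν_add : ∀ A B, ν (A + B) ≤ ν A + ν B)
    (hν_smul : ∀ (c : ℂ) (A), ν (c • A) = ‖c‖ * ν A) (hν_nonneg : ∀ A, 0 ≤ ν A) :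
    ∃ B : ℝ, 1 ≤ B ∧ ∀ u ∈ unitaryGroup ι ℂ, ν u ≤ B := by
  have hzero : ν 0 ≤ 0 := by simpa using (hν_smul 0 0).le
  refine ⟨max 1 (∑ i, ∑ j, ν (single i j 1)), le_max_left _ _, fun u hu => ?_⟩
  refine le_trans ?_ (le_max_right _ _)
  conv_lhs => rw [matrix_eq_sum_single u]
  refine (Finset.le_sum_of_subadditive ν hzero hν_add _ _).trans (Finset.sum_le_sum fun i _ => ?_)
  refine (Finset.le_sum_of_subadditive ν hzero hν_add _ _).trans (Finset.sum_le_sum fun j _ => ?_)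
  have h : single i j (u i j) = u i j • single i j (1 : ℂ) := by simp [smul_single]
  rw [h, hν_smul]
  exact mul_le_of_le_one_left (hν_nonneg _) (entry_norm_bound_of_unitary hu i j)

/-- The singular values of a matrix are controlled by any submultiplicative norm. -/
theorem exp_le_of_eq_unitary_mul_expDiag_mul_unitary
    (hν_nonneg : ∀ A, 0 ≤ ν A) (hν_eq_zero : ∀ A, ν A = 0 → A = 0)
    (hν_smul : ∀ (c : ℂ) (A), ν (c • A) = ‖c‖ * ν A)
    (hν_mul : ∀ A B, ν (A * B) ≤ ν A * ν B)
    {B : ℝ} (hB : ∀ u ∈ unitaryGroup ι ℂ, ν u ≤ B)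
    {x : GL ι ℂ} {u v : unitaryGroup ι ℂ} {t : ι → ℝ}
    (hx : x = Unitary.toUnits u * expDiag t * Unitary.toUnits v) (i : ι) :
    Real.exp (t i) ≤ B ^ 2 * ν x := by
  have hE : 0 < ν (single i i 1) := by
    refine (hν_nonneg _).lt_of_ne fun h => ?_
    have := congrFun (congrFun (hν_eq_zero _ h.symm) i) i
    simp at this
  have hB0 : 0 ≤ B := (hν_nonneg u).trans (hB u u.2)
  have hD : (expDiag t : Matrix ι ι ℂ) = star (u : Matrix ι ι ℂ) * x * star (v : Matrix ι ι ℂ) := by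
    have h : expDiag t = Unitary.toUnits u⁻¹ * x * Unitary.toUnits v⁻¹ := by
      rw [hx, map_inv, map_inv]
      group
    exact congrArg Units.val h
  have hDE : (expDiag t : Matrix ι ι ℂ) * single i i 1 =
      (Real.exp (t i) : ℂ) • single i i (1 : ℂ) := by
    ext a b
    by_cases h : i = a <;> simp [coe_expDiag, diagonal_mul, single_apply, h]
  have hmul : Real.exp (t i) * ν (single i i 1) ≤ ν (expDiag t : Matrix ι ι ℂ) * ν (single i i 1) := by
    have h := hν_mul (expDiag t) (single i i 1)
    rwa [hDE, hν_smul, Complex.norm_real, Real.norm_eq_abs, Real.abs_exp] at h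
  calc Real.exp (t i) ≤ ν (expDiag t : Matrix ι ι ℂ) := le_of_mul_le_mul_right hmul hE
    _ ≤ ν (star (u : Matrix ι ι ℂ)) * ν x * ν (star (v : Matrix ι ι ℂ)) := by
        rw [hD]
        exact (hν_mul _ _).trans (mul_le_mul_of_nonneg_right (hν_mul _ _) (hν_nonneg _))
    _ ≤ B * ν x * B := by
        gcongr
        · exact hν_nonneg _
        · exact mul_nonneg hB0 (hν_nonneg _)
        · exact hν_nonneg _
        · exact hB _ (star u).2
        · exact hB _ (star v).2
    _ = B ^ 2 * ν x := by ring

end SubmultiplicativeNorm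

/-- For any submultiplicative norm `ν` on the algebra of `n × n` complex matrices, every
semicharacter `f` on `GL_n(ℂ)` is majorized by a semicharacter of the form
`x ↦ C * (max (ν x) (ν x⁻¹))^N` with `C ≥ 1`, `N ∈ ℕ`. -/
theorem semicharacter_le_matrix_norm_power (n : ℕ) (hn : 1 ≤ n)
    (ν : Matrix (Fin n) (Fin n) ℂ → ℝ)
    (hν_nonneg : ∀ A, 0 ≤ ν A)
    (hν_eq_zero : ∀ A, ν A = 0 → A = 0)
    (hν_add : ∀ A B, ν (A + B) ≤ ν A + ν B)
    (hν_smul : ∀ (c : ℂ) (A), ν (c • A) = ‖c‖ * ν A)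
    (hν_mul : ∀ A B, ν (A * B) ≤ ν A * ν B)
    (f : GL (Fin n) ℂ → ℝ) (hf : IsSemicharacter f) :
    ∃ (C : ℝ) (N : ℕ), 1 ≤ C ∧ ∀ x : GL (Fin n) ℂ,
      f x ≤ C * (max (ν ↑x) (ν ↑x⁻¹)) ^ N := by
  have : Nonempty (Fin n) := ⟨⟨0, hn⟩⟩
  obtain ⟨B, hB1, hB⟩ := exists_bound_norm_unitaryGroup hν_add hν_smul hν_nonneg
  have hcompact : CompactSpace (unitaryGroup (Fin n) ℂ) :=
    isCompact_iff_compactSpace.1 isCompact_unitaryGroup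
  obtain ⟨M₁, hM₁⟩ := hf.exists_bound_of_isCompact
    (isCompact_range (continuous_unitary_toUnits (ι := Fin n)))
  obtain ⟨M₂, hM₂⟩ := hf.exists_bound_of_isCompact
    ((isCompact_Icc (a := (-1 : Fin n → ℝ)) (b := 1)).image continuous_expDiag)
  set M := max M₁ M₂
  have hMu (u : unitaryGroup (Fin n) ℂ) : f (Unitary.toUnits u) ≤ M :=
    (hM₁ _ ⟨u, rfl⟩).trans (le_max_left _ _)
  have hM1 : 1 ≤ M := (hf.one_le _).trans (hMu 1)
  have hM0 : 0 < M := zero_lt_one.trans_le hM1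
  have hf0 (y : GL (Fin n) ℂ) : 0 ≤ f y := zero_le_one.trans (hf.one_le y)
  set N := ⌈Real.log M⌉₊
  refine ⟨M ^ 4 * (B ^ 2) ^ N, N,
    one_le_mul_of_one_le_of_one_le (one_le_pow₀ hM1) (one_le_pow₀ (one_le_pow₀ hB1)), fun x => ?_⟩
  obtain ⟨u, v, t, hx⟩ := exists_eq_unitary_mul_expDiag_mul_unitary x
  have hx' : x⁻¹ = Unitary.toUnits v⁻¹ * expDiag (-t) * Unitary.toUnits u⁻¹ := by
    rw [hx, expDiag_neg, map_inv, map_inv]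
    group
  set m := max (ν ↑x) (ν ↑x⁻¹)
  have hB2 : 0 ≤ B ^ 2 := sq_nonneg B
  have hup (i : Fin n) : Real.exp (t i) ≤ B ^ 2 * m :=
    (exp_le_of_eq_unitary_mul_expDiag_mul_unitary hν_nonneg hν_eq_zero hν_smul hν_mul hB hx i).trans
      (mul_le_mul_of_nonneg_left (le_max_left _ _) hB2)
  have hlow (i : Fin n) : Real.exp (-t i) ≤ B ^ 2 * m :=
    (exp_le_of_eq_unitary_mul_expDiag_mul_unitary hν_nonneg hν_eq_zero hν_smul hν_mul hB hx' i).trans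
      (mul_le_mul_of_nonneg_left (le_max_right _ _) hB2)
  have hpos : 0 < B ^ 2 * m := (Real.exp_pos _).trans_le (hup (Classical.arbitrary _))
  set L := Real.log (B ^ 2 * m)
  have habs (i : Fin n) : |t i| ≤ L :=
    abs_le'.2 ⟨(Real.le_log_iff_exp_le hpos).2 (hup i), (Real.le_log_iff_exp_le hpos).2 (hlow i)⟩
  have hL0 : 0 ≤ L := (abs_nonneg _).trans (habs (Classical.arbitrary _))
  set k := ⌈L⌉₊
  have hk0 : (0 : ℝ) < (k + 1 : ℕ) := by positivity
  have hLk : L ≤ (k + 1 : ℕ) := (Nat.le_ceil L).trans (by push_cast; linarith)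
  set s : Fin n → ℝ := ((k + 1 : ℕ) : ℝ)⁻¹ • t with hs
  have hts : t = (k + 1) • s := by
    rw [hs, ← Nat.cast_smul_eq_nsmul ℝ, smul_inv_smul₀ hk0.ne']
  have hs1 (i : Fin n) : |s i| ≤ 1 := by
    rw [hs, Pi.smul_apply, smul_eq_mul, abs_mul, abs_of_pos (inv_pos.2 hk0),
      inv_mul_le_one₀ hk0]
    exact (habs i).trans hLk
  have hfs : f (expDiag s) ≤ M :=
    (hM₂ _ ⟨s, ⟨fun i => (abs_le.1 (hs1 i)).1, fun i => (abs_le.1 (hs1 i)).2⟩, rfl⟩).trans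
      (le_max_right _ _)
  have hft : f (expDiag t) ≤ M ^ (k + 1) := by
    rw [hts, expDiag_nsmul]
    exact (hf.pow_succ_le _ _).trans (pow_le_pow_left₀ (hf0 _) hfs _)
  have hMk : M ^ k ≤ M * (B ^ 2 * m) ^ N := by
    have h1 : M ^ k = Real.exp (Real.log M * k) := by
      rw [mul_comm, Real.exp_nat_mul, Real.exp_log hM0]
    have h2 : (B ^ 2 * m) ^ N = Real.exp (N * L) := by
      rw [Real.exp_nat_mul, Real.exp_log hpos]
    have hlogM : 0 ≤ Real.log M := Real.log_nonneg hM1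
    calc M ^ k = Real.exp (Real.log M * k) := h1
      _ ≤ Real.exp (Real.log M + N * L) := by
          refine Real.exp_le_exp.2 ?_
          have hkL : (k : ℝ) ≤ L + 1 := (Nat.ceil_lt_add_one hL0).le
          have hN : Real.log M * L ≤ N * L := mul_le_mul_of_nonneg_right (Nat.le_ceil _) hL0
          nlinarith [mul_le_mul_of_nonneg_left hkL hlogM]
      _ = M * (B ^ 2 * m) ^ N := by rw [Real.exp_add, Real.exp_log hM0, h2]
  calc f x ≤ f (Unitary.toUnits u) * f (expDiag t) * f (Unitary.toUnits v) := by
        rw [hx]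
        exact (hf.submul _ _).trans (mul_le_mul_of_nonneg_right (hf.submul _ _) (hf0 _))
    _ ≤ M * M ^ (k + 1) * M := by
        gcongr
        · exact hf0 _
        · exact hf0 _
        · exact hMu u
        · exact hMu v
    _ = M ^ 3 * M ^ k := by ring
    _ ≤ M ^ 3 * (M * (B ^ 2 * m) ^ N) := by gcongr
    _ = M ^ 4 * (B ^ 2) ^ N * m ^ N := by rw [mul_pow]; ring
end

section
/- Let ℂ^× = ℂ \ {0} be the multiplicative group of nonzero complex numbers with its usual topology. Then every semicharacter f on ℂ^× is majorized by a semicharacter of the form r(t) = C·(max(|t|, |t|⁻¹))^N: there exist C ≥ 1 and N ∈ ℕ such that f(t) ≤ C·(max(|t|, |t|⁻¹))^N for all t ∈ ℂ^×. -/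
theorem IsSemicharacter.exists_le_of_isCompact {G : Type*} [Group G] [TopologicalSpace G]
    {f : G → ℝ} (hf : IsSemicharacter f) {K : Set G} (hK : IsCompact K) :
    ∃ M : ℝ, ∀ x ∈ K, f x ≤ M := by
  refine hK.induction_on (p := fun s => ∃ M : ℝ, ∀ x ∈ s, f x ≤ M) ⟨0, by simp⟩ ?_ ?_ ?_
  · rintro s t hst ⟨M, hM⟩
    exact ⟨M, fun x hx => hM x (hst hx)⟩
  · rintro s t ⟨M, hM⟩ ⟨M', hM'⟩
    refine ⟨max M M', fun x hx => ?_⟩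
    rcases hx with hx | hx
    · exact (hM x hx).trans (le_max_left _ _)
    · exact (hM' x hx).trans (le_max_right _ _)
  · intro x _
    obtain ⟨U, hU, hbound⟩ := hf.locallyBounded x
    exact ⟨U, mem_nhdsWithin_of_mem_nhds hU, hbound⟩

theorem isCompact_units_annulus (R : ℝ) (hR : 0 < R) :
    IsCompact {t : ℂˣ | max ‖(t : ℂ)‖ (‖(t : ℂ)‖⁻¹) ≤ R} := by
  rw [Units.isEmbedding_val₀.isInducing.isCompact_iff]
  have h : ((↑) : ℂˣ → ℂ) '' {t : ℂˣ | max ‖(t : ℂ)‖ (‖(t : ℂ)‖⁻¹) ≤ R} =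
      Metric.closedBall 0 R ∩ {z : ℂ | R⁻¹ ≤ ‖z‖} := by
    ext z
    simp only [Set.mem_image, Set.mem_ofPred_eq, max_le_iff, Set.mem_inter_iff,
      mem_closedBall_zero_iff]
    constructor
    · rintro ⟨t, ⟨h₁, h₂⟩, rfl⟩
      exact ⟨h₁, inv_le_of_inv_le₀ (norm_pos_iff.2 t.ne_zero) h₂⟩
    · rintro ⟨h₁, h₂⟩
      have hz : 0 < ‖z‖ := (inv_pos.2 hR).trans_le h₂
      exact ⟨Units.mk0 z (norm_pos_iff.1 hz), ⟨h₁, inv_le_of_inv_le₀ hR h₂⟩, rfl⟩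
  rw [h]
  exact (isCompact_closedBall 0 R).inter_right (isClosed_le continuous_const continuous_norm)

/-- Outside the annulus of radius `2`, one can divide by `2` or `2⁻¹` to halve
`max ‖t‖ ‖t‖⁻¹`. -/
theorem exists_units_mul_eq_of_two_lt (t : ℂˣ) (ht : 2 < max ‖(t : ℂ)‖ (‖(t : ℂ)‖⁻¹)) :
    ∃ u s : ℂˣ, t = u * s ∧ max ‖(u : ℂ)‖ (‖(u : ℂ)‖⁻¹) ≤ 2 ∧
      max ‖(s : ℂ)‖ (‖(s : ℂ)‖⁻¹) = max ‖(t : ℂ)‖ (‖(t : ℂ)‖⁻¹) / 2 := by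
  let two : ℂˣ := Units.mk0 2 two_ne_zero
  have key : ∀ a : ℝ, 2 < a → max (a / 2) (a / 2)⁻¹ = max a a⁻¹ / 2 := by
    intro a ha
    have h₁ : a⁻¹ ≤ 1 := inv_le_one_of_one_le₀ (by linarith)
    have h₂ : (a / 2)⁻¹ ≤ 1 := inv_le_one_of_one_le₀ (by linarith)
    rw [max_eq_left (by linarith), max_eq_left (by linarith)]
  rcases lt_max_iff.1 ht with h | h
  · refine ⟨two, two⁻¹ * t, by simp, by norm_num [two], ?_⟩
    have hs : ‖((two⁻¹ * t : ℂˣ) : ℂ)‖ = ‖(t : ℂ)‖ / 2 := by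
      simp [two, div_eq_inv_mul]
    rw [hs, key _ h]
  · refine ⟨two⁻¹, two * t, by simp, by norm_num [two], ?_⟩
    have hs : ‖((two * t : ℂˣ) : ℂ)‖ = (‖(t : ℂ)‖⁻¹ / 2)⁻¹ := by
      simp [two]
    rw [hs, inv_inv, max_comm, key _ h, inv_inv, max_comm]

/-- On the complex circle `ℂ^× = ℂ \ {0}`, every semicharacter `f` is majorized by a
semicharacter of the form `t ↦ C * (max |t| |t|⁻¹)^N` with `C ≥ 1`, `N ∈ ℕ`. -/
theorem semicharacter_on_complex_circle (f : ℂˣ → ℝ) (hf : IsSemicharacter f) :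
    ∃ (C : ℝ) (N : ℕ), 1 ≤ C ∧ ∀ t : ℂˣ,
      f t ≤ C * (max ‖(t : ℂ)‖ (‖(t : ℂ)‖⁻¹)) ^ N := by
  obtain ⟨M, hM⟩ := hf.exists_le_of_isCompact (isCompact_units_annulus 2 two_pos)
  have hM1 : 1 ≤ M := (hf.one_le 1).trans (hM 1 (by simp))
  obtain ⟨N, hN⟩ := pow_unbounded_of_one_lt M (one_lt_two : (1 : ℝ) < 2)
  have hmax : ∀ t : ℂˣ, 1 ≤ max ‖(t : ℂ)‖ (‖(t : ℂ)‖⁻¹) := by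
    intro t
    rcases le_total 1 ‖(t : ℂ)‖ with h | h
    · exact h.trans (le_max_left _ _)
    · exact ((one_le_inv₀ (norm_pos_iff.2 t.ne_zero)).2 h).trans (le_max_right _ _)
  have bound : ∀ (n : ℕ) (t : ℂˣ), max ‖(t : ℂ)‖ (‖(t : ℂ)‖⁻¹) ≤ 2 ^ n →
      f t ≤ M * (max ‖(t : ℂ)‖ (‖(t : ℂ)‖⁻¹)) ^ N := by
    intro n
    have small : ∀ t : ℂˣ, max ‖(t : ℂ)‖ (‖(t : ℂ)‖⁻¹) ≤ 2 →
        f t ≤ M * (max ‖(t : ℂ)‖ (‖(t : ℂ)‖⁻¹)) ^ N := fun t ht =>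
      (hM t ht).trans (le_mul_of_one_le_right (by linarith) (one_le_pow₀ (hmax t)))
    induction n with
    | zero => exact fun t ht => small t (ht.trans (by norm_num))
    | succ n ih =>
      intro t ht
      rcases le_or_gt (max ‖(t : ℂ)‖ (‖(t : ℂ)‖⁻¹)) 2 with h | h
      · exact small t h
      obtain ⟨u, s, hus, hu, hs⟩ := exists_units_mul_eq_of_two_lt t h
      have hfs := ih s (by rw [hs, div_le_iff₀ two_pos, ← pow_succ]; exact ht)
      rw [hs] at hfs
      set m := max ‖(t : ℂ)‖ (‖(t : ℂ)‖⁻¹)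
      calc f t ≤ f u * f s := hus ▸ hf.submul u s
        _ ≤ 2 ^ N * (M * (m / 2) ^ N) :=
          mul_le_mul ((hM u hu).trans hN.le) hfs (zero_le_one.trans (hf.one_le s)) (by positivity)
        _ = M * m ^ N := by rw [div_pow]; field_simp
  refine ⟨M, N, hM1, fun t => ?_⟩
  obtain ⟨n, hn⟩ := pow_unbounded_of_one_lt (max ‖(t : ℂ)‖ (‖(t : ℂ)‖⁻¹))
    (one_lt_two : (1 : ℝ) < 2)
  exact bound n t hn.le
end

section
/- Let A be an associative unital algebra over ℂ, let r : A → ℝ satisfy 0 ≤ r(a), r(c • a) = |c|·r(a) for c ∈ ℂ, and r(a·b) ≤ r(a)·r(b) for all a, b ∈ A (a submultiplicative absolutely homogeneous nonnegative functional). Suppose t, z, w ∈ A and q ∈ ℂ satisfy z·w = 1 = w·z and t·z = q • (z·t), and |q| ≠ 1. Then there exists K ∈ ℕ such that r(t^k) = 0 for all k > K. (Concretely: if |q| < 1 then r(t^k) = 0 whenever |q|^k·r(z)·r(w) < 1, and if |q| > 1 then r(t^k) = 0 whenever r(z)·r(w)/|q|^k < 1.) -/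
/-- If `t` and `z` commute up to the scalar `q`, then `t ^ k` and `z` commute up to `q ^ k`. -/
lemma pow_mul_eq_pow_smul_mul_pow {R A : Type*} [CommSemiring R] [Semiring A] [Algebra R A]
    {t z : A} {q : R} (htz : t * z = q • (z * t)) (k : ℕ) :
    t ^ k * z = q ^ k • (z * t ^ k) := by
  induction k with
  | zero => simp
  | succ k ih =>
    rw [pow_succ, mul_assoc, htz, mul_smul_comm, ← mul_assoc, ih, smul_mul_assoc, smul_smul,
      mul_assoc, ← pow_succ, ← pow_succ']

/-- A nonnegative real bounded by a multiple of itself with factor less than one vanishes. -/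
lemma eq_zero_of_le_mul_self_of_lt_one {x c : ℝ} (hx : 0 ≤ x) (h : x ≤ c * x) (hc : c < 1) :
    x = 0 := by
  nlinarith

/-- Let `r` be a nonnegative, absolutely homogeneous, submultiplicative functional on a unital
`ℂ`-algebra `A`, and let `t, z, w ∈ A`, `q ∈ ℂ` satisfy `z·w = 1 = w·z`, `t·z = q • (z·t)` and
`|q| ≠ 1`. Then `r(t^k) = 0` for all sufficiently large `k`; concretely, if `|q| < 1` then
`r(t^k) = 0` whenever `|q|^k·r(z)·r(w) < 1`, and if `|q| > 1` then `r(t^k) = 0` whenever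
`r(z)·r(w)/|q|^k < 1`. -/
theorem seminorm_kills_powers_of_t {A : Type*} [Ring A] [Algebra ℂ A]
    (r : A → ℝ) (hr_nonneg : ∀ a, 0 ≤ r a)
    (hr_smul : ∀ (c : ℂ) (a : A), r (c • a) = ‖c‖ * r a)
    (hr_mul : ∀ a b : A, r (a * b) ≤ r a * r b)
    (t z w : A) (q : ℂ) (hzw : z * w = 1) (hwz : w * z = 1)
    (htz : t * z = q • (z * t)) (hq : ‖q‖ ≠ 1) :
    (∃ K : ℕ, ∀ k : ℕ, K < k → r (t ^ k) = 0) ∧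
    (‖q‖ < 1 → ∀ k : ℕ, ‖q‖ ^ k * r z * r w < 1 → r (t ^ k) = 0) ∧
    (1 < ‖q‖ → ∀ k : ℕ, r z * r w / ‖q‖ ^ k < 1 → r (t ^ k) = 0) := by
  have hcomm := pow_mul_eq_pow_smul_mul_pow htz
  have bound (a b c : A) : r (a * b * c) ≤ r a * r b * r c :=
    (hr_mul _ _).trans (mul_le_mul_of_nonneg_right (hr_mul _ _) (hr_nonneg _))
  have small (k : ℕ) (hk : ‖q‖ ^ k * r z * r w < 1) : r (t ^ k) = 0 := by
    refine eq_zero_of_le_mul_self_of_lt_one (hr_nonneg _) ?_ hk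
    have key : t ^ k = q ^ k • (z * t ^ k * w) := by
      rw [← smul_mul_assoc, ← hcomm, mul_assoc, hzw, mul_one]
    calc r (t ^ k) = ‖q‖ ^ k * r (z * t ^ k * w) := by
          conv_lhs => rw [key, hr_smul, norm_pow]
      _ ≤ ‖q‖ ^ k * (r z * r (t ^ k) * r w) := by gcongr; exact bound _ _ _
      _ = ‖q‖ ^ k * r z * r w * r (t ^ k) := by ring
  have large (hq1 : 1 < ‖q‖) (k : ℕ) (hk : r z * r w / ‖q‖ ^ k < 1) : r (t ^ k) = 0 := by
    have hpos : 0 < ‖q‖ ^ k := by positivity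
    refine eq_zero_of_le_mul_self_of_lt_one (hr_nonneg _) ?_ hk
    have key : q ^ k • t ^ k = w * t ^ k * z := by
      rw [mul_assoc, hcomm, mul_smul_comm, ← mul_assoc, hwz, one_mul]
    have h := bound w (t ^ k) z
    rw [← key, hr_smul, norm_pow] at h
    rw [div_mul_eq_mul_div, le_div_iff₀ hpos]
    linarith
  refine ⟨?_, fun _ => small, large⟩
  suffices h : ∀ᶠ k in Filter.atTop, r (t ^ k) = 0 by
    obtain ⟨K, hK⟩ := Filter.eventually_atTop.1 h
    exact ⟨K, fun k hk => hK k hk.le⟩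
  rcases hq.lt_or_gt with hlt | hgt
  · have hlim : Filter.Tendsto (fun k : ℕ => ‖q‖ ^ k * r z * r w) Filter.atTop (nhds 0) := by
      simpa using ((tendsto_pow_atTop_nhds_zero_of_lt_one (norm_nonneg q) hlt).mul_const
        (r z)).mul_const (r w)
    exact (hlim.eventually_lt_const one_pos).mono small
  · have hlim : Filter.Tendsto (fun k : ℕ => r z * r w / ‖q‖ ^ k) Filter.atTop (nhds 0) :=
      (tendsto_pow_atTop_atTop_of_one_lt hgt).const_div_atTop _
    exact (hlim.eventually_lt_const one_pos).mono (large hgt)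
end

section
/- Let p : ℤ × ℕ → ℝ be a function with p(m, k) ≥ 0 for all (m, k) and satisfying the skew submultiplicativity inequality p(m, k + l) ≤ p(m, k)·p(m + k, l) for all m ∈ ℤ and k, l ∈ ℕ. If the set S₀ = { n ∈ ℤ : p(n, 0) ≠ 0 } is finite, then the whole set { (n, k) ∈ ℤ × ℕ : p(n, k) ≠ 0 } is finite; more precisely, setting S_k = { n : p(n, k) ≠ 0 }, one has S_{k+1} ⊆ S_k ∩ (S₀ − (k+1)) for every k, and S_k = ∅ for all k > max S₀ − min S₀. -/
/-- The support of a nonnegative skew submultiplicative function is closed under passing to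
the two factors of a decomposition `k + l`. -/
lemma ne_zero_and_ne_zero_of_skew_submultiplicative {p : ℤ × ℕ → ℝ}
    (hp_nonneg : ∀ (m : ℤ) (k : ℕ), 0 ≤ p (m, k))
    (hp_sub : ∀ (m : ℤ) (k l : ℕ), p (m, k + l) ≤ p (m, k) * p (m + (k : ℤ), l))
    {m : ℤ} {k l : ℕ} (h : p (m, k + l) ≠ 0) :
    p (m, k) ≠ 0 ∧ p (m + (k : ℤ), l) ≠ 0 := by
  rw [← mul_ne_zero_iff]
  exact (((hp_nonneg m (k + l)).lt_of_ne' h).trans_le (hp_sub m k l)).ne'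

/-- Let `p : ℤ × ℕ → ℝ` be nonnegative with `p(m, k+l) ≤ p(m,k)·p(m+k,l)`, and suppose
`S₀ = { n : p(n,0) ≠ 0 }` is finite. Then `{ (n,k) : p(n,k) ≠ 0 }` is finite; more precisely
`S_{k+1} ⊆ S_k ∩ (S₀ − (k+1))` for every `k`, and `S_k = ∅` whenever
`k > max S₀ − min S₀` (i.e. whenever `a − b < k` for all `a, b ∈ S₀`). -/
theorem skew_submultiplicative_support_finite (p : ℤ × ℕ → ℝ)
    (hp_nonneg : ∀ (m : ℤ) (k : ℕ), 0 ≤ p (m, k))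
    (hp_sub : ∀ (m : ℤ) (k l : ℕ), p (m, k + l) ≤ p (m, k) * p (m + (k : ℤ), l))
    (hS0 : {n : ℤ | p (n, 0) ≠ 0}.Finite) :
    {x : ℤ × ℕ | p x ≠ 0}.Finite ∧
    (∀ k : ℕ, {n : ℤ | p (n, k + 1) ≠ 0} ⊆
      {n : ℤ | p (n, k) ≠ 0} ∩ ((fun n => n - ((k : ℤ) + 1)) '' {n : ℤ | p (n, 0) ≠ 0})) ∧
    (∀ k : ℕ, (∀ a b : ℤ, p (a, 0) ≠ 0 → p (b, 0) ≠ 0 → a - b < (k : ℤ)) →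
      ∀ n : ℤ, p (n, k) = 0) := by
  have hleft {n : ℤ} {k : ℕ} (h : p (n, k) ≠ 0) : p (n, 0) ≠ 0 :=
    (ne_zero_and_ne_zero_of_skew_submultiplicative hp_nonneg hp_sub (l := k)
      (by rwa [zero_add])).1
  have hright {n : ℤ} {k : ℕ} (h : p (n, k) ≠ 0) : p (n + (k : ℤ), 0) ≠ 0 :=
    (ne_zero_and_ne_zero_of_skew_submultiplicative hp_nonneg hp_sub (l := 0) h).2
  refine ⟨?_, fun k n hn => ⟨?_, n + ((k : ℤ) + 1), ?_, by simp⟩, fun k hk n => ?_⟩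
  · have hinj : Function.Injective fun x : ℤ × ℕ => (x.1, x.1 + (x.2 : ℤ)) := by
      rintro ⟨n, k⟩ ⟨m, l⟩ h
      simp only [Prod.mk.injEq] at h ⊢
      omega
    exact ((hS0.prod hS0).preimage hinj.injOn).subset fun _ hx => ⟨hleft hx, hright hx⟩
  · exact (ne_zero_and_ne_zero_of_skew_submultiplicative hp_nonneg hp_sub hn).1
  · simpa using hright hn
  · by_contra h
    have := hk _ _ (hright h) (hleft h)
    omega
end

section
/- Let X and Y be complex Banach spaces and φ : X → Y a compact continuous linear operator (the image of some neighborhood of zero is contained in a compact set). Then the second Banach dual operator φ** : X** → Y** maps X** into (the canonical image of) Y: for every continuous linear functional Φ on the dual space X* there exists y ∈ Y such that Φ(g ∘ φ) = g(y) for every continuous linear functional g on Y. -/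
/-- A functional on a complex normed space whose real part is at most `u` on the unit ball has
norm at most `u`. -/
theorem ContinuousLinearMap.opNorm_le_of_re_le {X : Type*} [NormedAddCommGroup X]
    [NormedSpace ℂ X] (f : X →L[ℂ] ℂ) {u : ℝ} (hf : ∀ x, ‖x‖ ≤ 1 → (f x).re ≤ u) : ‖f‖ ≤ u := by
  have hu : 0 ≤ u := by simpa using hf 0 (by simp)
  refine ContinuousLinearMap.opNorm_le_of_unit_norm hu fun x hx ↦ ?_
  obtain ⟨c, hc, hcx⟩ := Complex.exists_norm_eq_mul_self (f x)
  have h := hf (c • x) (by simp [norm_smul, hc, hx])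
  rwa [map_smul, smul_eq_mul, ← hcx, Complex.ofReal_re] at h

/-- A weak form of Helly's theorem: for finitely many functionals `g i` on `Y`, the values
`Φ (g i ∘ φ)` are attained at a common point of the closure of the image of the closed ball of
radius `‖Φ‖`, provided this closure is compact. -/
theorem exists_mem_closure_image_closedBall_forall_eq {ι X Y : Type*} [Finite ι]
    [NormedAddCommGroup X] [NormedSpace ℂ X] [NormedAddCommGroup Y] [NormedSpace ℂ Y]
    (φ : X →L[ℂ] Y) (Φ : (X →L[ℂ] ℂ) →L[ℂ] ℂ)
    (hK : IsCompact (closure (φ '' Metric.closedBall 0 ‖Φ‖))) (g : ι → Y →L[ℂ] ℂ) :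
    ∃ y ∈ closure (φ '' Metric.closedBall 0 ‖Φ‖), ∀ i, Φ ((g i).comp φ) = g i y := by
  classical
  have := Fintype.ofFinite ι
  set K := closure (φ '' Metric.closedBall 0 ‖Φ‖)
  let T : Y →L[ℂ] (ι → ℂ) := ContinuousLinearMap.pi g
  let v : ι → ℂ := fun i ↦ Φ ((g i).comp φ)
  suffices hv : v ∈ T '' K by
    obtain ⟨y, hy, hyv⟩ := hv
    exact ⟨y, hy, fun i ↦ (congrFun hyv i).symm⟩
  by_contra hv
  have hconv : Convex ℝ (T '' K) :=
    ((((convex_closedBall (0 : X) ‖Φ‖).linear_image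
      (φ.restrictScalars ℝ).toLinearMap).closure).linear_image (T.restrictScalars ℝ).toLinearMap)
  obtain ⟨f, u, hfu, huv⟩ := RCLike.geometric_hahn_banach_closed_point (𝕜 := ℂ) hconv
    (hK.image T.continuous).isClosed hv
  let ψ : X →L[ℂ] ℂ := (f.comp T).comp φ
  have hfv : f v = Φ ψ := by
    have hψ : ψ = ∑ i, f (fun j ↦ if i = j then 1 else 0) • (g i).comp φ := by
      ext x
      have := f.toLinearMap.pi_apply_eq_sum_univ (T (φ x))
      simpa [ψ, T, mul_comm] using this
    rw [hψ, map_sum]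
    have := f.toLinearMap.pi_apply_eq_sum_univ v
    simpa [v, mul_comm] using this
  have hle : ‖(‖Φ‖ : ℂ) • ψ‖ ≤ u := by
    refine ContinuousLinearMap.opNorm_le_of_re_le _ fun x hx ↦ ?_
    have hmem : φ ((‖Φ‖ : ℂ) • x) ∈ K := by
      refine subset_closure ⟨_, ?_, rfl⟩
      simpa [norm_smul, abs_of_nonneg (norm_nonneg Φ)] using mul_le_of_le_one_right (norm_nonneg Φ) hx
    simpa [ψ] using (hfu _ ⟨_, hmem, rfl⟩).le
  have : ‖Φ‖ * ‖ψ‖ ≤ u := by simpa [norm_smul, abs_of_nonneg (norm_nonneg Φ)] using hle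
  have : (f v).re ≤ ‖Φ‖ * ‖ψ‖ :=
    (Complex.re_le_norm _).trans (hfv ▸ Φ.le_opNorm ψ)
  have : u < (f v).re := huv
  linarith

/-- If `φ : X → Y` is a compact continuous linear operator between complex Banach spaces, then
its second Banach dual maps `X**` into (the canonical image of) `Y`: for every continuous
linear functional `Φ` on `X*` there is `y ∈ Y` with `Φ(g ∘ φ) = g(y)` for all `g ∈ Y*`. -/
theorem compactOperator_bidual_maps_into_range {X Y : Type*}
    [NormedAddCommGroup X] [NormedSpace ℂ X] [CompleteSpace X]
    [NormedAddCommGroup Y] [NormedSpace ℂ Y] [CompleteSpace Y]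
    (φ : X →L[ℂ] Y) (hφ : IsCompactOperator φ) :
    ∀ Φ : (X →L[ℂ] ℂ) →L[ℂ] ℂ, ∃ y : Y, ∀ g : Y →L[ℂ] ℂ, Φ (g.comp φ) = g y := by
  intro Φ
  have hK : IsCompact (closure (φ '' Metric.closedBall 0 ‖Φ‖)) :=
    hφ.isCompact_closure_image_closedBall (f := φ.toLinearMap) ‖Φ‖
  obtain ⟨y, -, hy⟩ := hK.inter_iInter_nonempty
    (fun g : Y →L[ℂ] ℂ ↦ {y | Φ (g.comp φ) = g y})
    (fun g ↦ isClosed_eq continuous_const g.continuous) fun s ↦ by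
      obtain ⟨y, hyK, hy⟩ := exists_mem_closure_image_closedBall_forall_eq φ Φ hK
        (fun g : s ↦ (g : Y →L[ℂ] ℂ))
      exact ⟨y, hyK, Set.mem_iInter₂.2 fun g hg ↦ hy ⟨g, hg⟩⟩
  exact ⟨y, fun g ↦ Set.mem_iInter.1 hy g⟩
end
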